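/- Let G = (V, ω) be a finite connected weighted graph with vertex measure μ. Let h, f : V → ℝ with f_i > 0 for all i ∈ V, and let α > 2. Then there exist a constant λ ∈ ℝ and a function φ : V → ℝ with φ_i > 0 for all i ∈ V such that (Δ φ)_i + h_i φ_i = λ f_i φ_i^{α−1} for every i ∈ V, where Δ = Δ_2 is the graph Laplacian (Δ φ)_i = (1/μ_i) Σ_{j∈V} ω_ij (φ_j − φ_i). -/

import Mathlib

open Matrix

/-- The quotient of a quadratic form by the power `2 / α` of a weighted `α`-power sum attains its
maximum over the nonnegative nonzero vectors. -/
lemma exists_maximizer_quadratic_form_rpow {V : Type*} [Fintype V] [Nonempty V]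
    (B : Matrix V V ℝ) (m : V → ℝ) (hm : ∀ i, 0 < m i) {α : ℝ} (hα : 0 < α) :
    ∃ (c : ℝ) (φ : V → ℝ), (∀ i, 0 ≤ φ i) ∧ (∃ i, 0 < φ i) ∧
      φ ⬝ᵥ B *ᵥ φ = c * (∑ i, m i * φ i ^ α) ^ (2 / α) ∧
      ∀ x : V → ℝ, (∀ i, 0 ≤ x i) →
        x ⬝ᵥ B *ᵥ x ≤ c * (∑ i, m i * x i ^ α) ^ (2 / α) := by
  classical
  have exists_pos : ∀ x ∈ stdSimplex ℝ V, ∃ i, 0 < x i := by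
    intro x hx
    by_contra! hle
    have hsum := Finset.sum_nonpos fun i (_ : i ∈ Finset.univ) => hle i
    linarith [hx.2]
  have sum_pos : ∀ x : V → ℝ, (∀ i, 0 ≤ x i) → (∃ i, 0 < x i) →
      0 < ∑ i, m i * x i ^ α := by
    rintro x hx ⟨i, hi⟩
    exact Finset.sum_pos' (fun j _ => mul_nonneg (hm j).le (Real.rpow_nonneg (hx j) _))
      ⟨i, Finset.mem_univ i, mul_pos (hm i) (Real.rpow_pos_of_pos hi _)⟩
  have hcont_sum : Continuous fun x : V → ℝ => ∑ i, m i * x i ^ α :=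
    continuous_finsetSum _ fun i _ =>
      continuous_const.mul ((continuous_apply i).rpow_const fun _ => Or.inr hα.le)
  have hcont : ContinuousOn
      (fun x : V → ℝ => (x ⬝ᵥ B *ᵥ x) / (∑ i, m i * x i ^ α) ^ (2 / α)) (stdSimplex ℝ V) := by
    refine ContinuousOn.div ?_ ?_ ?_
    · exact (continuous_id.dotProduct (continuous_const.matrix_mulVec continuous_id)).continuousOn
    · exact (hcont_sum.rpow_const fun _ => Or.inr (by positivity)).continuousOn
    · intro x hx
      exact (Real.rpow_pos_of_pos (sum_pos x hx.1 (exists_pos x hx)) _).ne'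
  obtain ⟨φ, hφ, hmax⟩ := (isCompact_stdSimplex ℝ V).exists_isMaxOn
    ⟨_, single_mem_stdSimplex ℝ (Classical.arbitrary V)⟩ hcont
  refine ⟨_, φ, hφ.1, exists_pos φ hφ, (div_mul_cancel₀ _
    (Real.rpow_pos_of_pos (sum_pos φ hφ.1 (exists_pos φ hφ)) _).ne').symm, fun x hx => ?_⟩
  by_cases hpos : ∃ i, 0 < x i
  · obtain ⟨i, hi⟩ := hpos
    have hs : 0 < ∑ j, x j :=
      Finset.sum_pos' (fun j _ => hx j) ⟨i, Finset.mem_univ i, hi⟩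
    set s := ∑ j, x j with hs_def
    set y : V → ℝ := s⁻¹ • x with hy
    have hymem : y ∈ stdSimplex ℝ V := by
      refine ⟨fun j => mul_nonneg (inv_nonneg.2 hs.le) (hx j), ?_⟩
      simp only [hy, Pi.smul_apply, smul_eq_mul, ← Finset.mul_sum, ← hs_def]
      exact inv_mul_cancel₀ hs.ne'
    have hxy : x = s • y := by rw [hy, smul_inv_smul₀ hs.ne']
    have hN := sum_pos y hymem.1 (exists_pos y hymem)
    have hle := (div_le_iff₀ (Real.rpow_pos_of_pos hN (2 / α))).1 (hmax hymem)
    have hsum : (∑ j, m j * x j ^ α) ^ (2 / α) = s ^ 2 * (∑ j, m j * y j ^ α) ^ (2 / α) := by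
      have : ∑ j, m j * x j ^ α = s ^ α * ∑ j, m j * y j ^ α := by
        rw [Finset.mul_sum]
        refine Finset.sum_congr rfl fun j _ => ?_
        rw [hxy, Pi.smul_apply, smul_eq_mul, Real.mul_rpow hs.le (hymem.1 j)]
        ring
      rw [this, Real.mul_rpow (by positivity) hN.le, ← Real.rpow_mul hs.le,
        mul_div_cancel₀ _ hα.ne', Real.rpow_two]
    rw [hsum]
    have hquad : x ⬝ᵥ B *ᵥ x = s ^ 2 * (y ⬝ᵥ B *ᵥ y) := by
      rw [hxy, mulVec_smul, dotProduct_smul, smul_dotProduct, smul_eq_mul, smul_eq_mul]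
      ring
    rw [hquad, mul_left_comm]
    exact mul_le_mul_of_nonneg_left hle (sq_nonneg s)
  · push Not at hpos
    have hx0 : x = 0 := funext fun i => le_antisymm (hpos i) (hx i)
    have h2 : 2 / α ≠ 0 := by positivity
    simp [hx0, Real.zero_rpow hα.ne', Real.zero_rpow h2]

lemma hasDerivAt_quadratic_form_add_smul_single {V : Type*} [Fintype V] [DecidableEq V]
    {B : Matrix V V ℝ} (hB : B.IsSymm) (φ : V → ℝ) (i : V) :
    HasDerivAt (fun t : ℝ => (φ + t • Pi.single i 1) ⬝ᵥ B *ᵥ (φ + t • Pi.single i 1))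
      (2 * (B *ᵥ φ) i) 0 := by
  have hexp : (fun t : ℝ => (φ + t • Pi.single i 1) ⬝ᵥ B *ᵥ (φ + t • Pi.single i 1)) =
      fun t => φ ⬝ᵥ B *ᵥ φ + t * (2 * (B *ᵥ φ) i) + t ^ 2 * B i i := by
    funext t
    have hcross : φ ⬝ᵥ B *ᵥ Pi.single i 1 = (B *ᵥ φ) i := by
      rw [dotProduct_mulVec, ← mulVec_transpose, hB.eq, dotProduct_single_one]
    have hdiag : (B *ᵥ Pi.single i 1) i = B i i := by simp
    simp only [mulVec_add, mulVec_smul, dotProduct_add, add_dotProduct, dotProduct_smul,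
      smul_dotProduct, smul_eq_mul, single_one_dotProduct, hcross, hdiag]
    ring
  rw [hexp]
  have := (((hasDerivAt_id' (0 : ℝ)).mul_const (2 * (B *ᵥ φ) i)).const_add (φ ⬝ᵥ B *ᵥ φ)).fun_add
    ((hasDerivAt_pow 2 (0 : ℝ)).mul_const (B i i))
  simpa using this

lemma hasDerivAt_sum_rpow_add_smul_single {V : Type*} [Fintype V] [DecidableEq V]
    (m φ : V → ℝ) {α : ℝ} (hα : 1 ≤ α) (i : V) :
    HasDerivAt (fun t : ℝ => ∑ j, m j * (φ + t • Pi.single i 1 : V → ℝ) j ^ α)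
      (α * (m i * φ i ^ (α - 1))) 0 := by
  have hcoord : ∀ j, HasDerivAt (fun t : ℝ => m j * (φ + t • Pi.single i 1 : V → ℝ) j ^ α)
      (m j * ((Pi.single i 1 : V → ℝ) j * α * φ j ^ (α - 1))) 0 := by
    intro j
    have hlin : HasDerivAt (fun t : ℝ => (φ + t • Pi.single i 1 : V → ℝ) j)
        ((Pi.single i 1 : V → ℝ) j) 0 := by
      simpa using ((hasDerivAt_id (0 : ℝ)).mul_const ((Pi.single i 1 : V → ℝ) j)).const_add (φ j)
    simpa using (hlin.rpow_const (Or.inr hα)).const_mul (m j)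
  refine (HasDerivAt.fun_sum fun j (_ : j ∈ Finset.univ) => hcoord j).congr_deriv ?_
  simp [Pi.single_apply]
  ring

/-- A maximum over `[0, ∞)` at the left endpoint forces a nonpositive derivative. -/
lemma HasDerivAt.nonpos_of_forall_nonneg_le {g : ℝ → ℝ} {g' : ℝ} (hg : HasDerivAt g g' 0)
    (hle : ∀ t, 0 ≤ t → g t ≤ g 0) : g' ≤ 0 := by
  refine le_of_tendsto (hasDerivWithinAt_iff_tendsto_slope' (by simp) |>.1
    (hg.hasDerivWithinAt (s := Set.Ioi 0))) ?_
  filter_upwards [self_mem_nhdsWithin] with t ht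
  rw [slope_def_field]
  exact div_nonpos_of_nonpos_of_nonneg (sub_nonpos.2 (hle t (le_of_lt ht)))
    (by simpa using le_of_lt ht)

/-- An irreducible symmetric matrix with nonnegative off-diagonal entries has a positive solution
of the nonlinear eigenvalue problem `B φ = c m φ ^ (α - 1)`. -/
lemma exists_pos_nonlinear_eigenvector {V : Type*} [Fintype V] [Nonempty V]
    {B : Matrix V V ℝ} (hB : B.IsSymm) (hoff : ∀ i j, i ≠ j → 0 ≤ B i j)
    (hirr : ∀ i j : V, Relation.ReflTransGen (fun a b => a ≠ b ∧ 0 < B a b) i j)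
    (m : V → ℝ) (hm : ∀ i, 0 < m i) {α : ℝ} (hα : 1 < α) :
    ∃ (c : ℝ) (φ : V → ℝ), (∀ i, 0 < φ i) ∧
      ∀ i, (B *ᵥ φ) i = c * (m i * φ i ^ (α - 1)) := by
  classical
  obtain ⟨c, φ, hφ, ⟨k, hk⟩, heq, hle⟩ :=
    exists_maximizer_quadratic_form_rpow B m hm (zero_lt_one.trans hα)
  set N := ∑ i, m i * φ i ^ α with hN_def
  have hN : 0 < N :=
    Finset.sum_pos' (fun j _ => mul_nonneg (hm j).le (Real.rpow_nonneg (hφ j) _))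
      ⟨k, Finset.mem_univ k, mul_pos (hm k) (Real.rpow_pos_of_pos hk _)⟩
  let g : V → ℝ → ℝ := fun i t =>
    (φ + t • Pi.single i 1) ⬝ᵥ B *ᵥ (φ + t • Pi.single i 1) -
      c * (∑ j, m j * (φ + t • Pi.single i 1 : V → ℝ) j ^ α) ^ (2 / α)
  have hg0 : ∀ i, g i 0 = 0 := fun i => by simp [g, heq, ← hN_def]
  have hg : ∀ i, HasDerivAt (g i)
      (2 * ((B *ᵥ φ) i - c * N ^ (2 / α - 1) * (m i * φ i ^ (α - 1)))) 0 := by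
    intro i
    have hN0 : ∑ j, m j * (φ + (0 : ℝ) • Pi.single i 1 : V → ℝ) j ^ α = N := by simp [hN_def]
    have hpow := (hasDerivAt_sum_rpow_add_smul_single m φ hα.le i).rpow_const (p := 2 / α)
      (Or.inl (by rw [hN0]; exact hN.ne'))
    rw [hN0] at hpow
    refine ((hasDerivAt_quadratic_form_add_smul_single hB φ i).sub
      (hpow.const_mul c)).congr_deriv ?_
    field_simp
  have hg_le : ∀ i t, (∀ j, 0 ≤ (φ + t • Pi.single i 1 : V → ℝ) j) → g i t ≤ g i 0 := by
    intro i t ht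
    rw [hg0]
    exact sub_nonpos.2 (hle _ ht)
  have hineq : ∀ i, (B *ᵥ φ) i ≤ c * N ^ (2 / α - 1) * (m i * φ i ^ (α - 1)) := by
    intro i
    have := (hg i).nonpos_of_forall_nonneg_le fun t ht => hg_le i t fun j => by
      have : 0 ≤ (Pi.single i 1 : V → ℝ) j := by
        rw [Pi.single_apply]; split_ifs <;> norm_num
      exact add_nonneg (hφ j) (mul_nonneg ht this)
    linarith
  have hstep : ∀ i j, i ≠ j → 0 < B i j → 0 < φ j → 0 < φ i := by
    intro i j hij hBij hj
    refine (hφ i).lt_of_ne fun h0 => ?_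
    have h1 := hineq i
    rw [← h0, Real.zero_rpow (sub_pos.2 hα).ne', mul_zero, mul_zero] at h1
    refine absurd h1 (not_le.2 ?_)
    refine Finset.sum_pos' (fun l _ => ?_) ⟨j, Finset.mem_univ j, mul_pos hBij hj⟩
    by_cases hl : i = l
    · simp [← hl, ← h0]
    · exact mul_nonneg (hoff i l hl) (hφ l)
  have hpos : ∀ i, 0 < φ i := by
    intro i
    induction hirr i k using Relation.ReflTransGen.head_induction_on with
    | refl => exact hk
    | head hab _ ih => exact hstep _ _ hab.1 hab.2 ih
  refine ⟨c * N ^ (2 / α - 1), φ, hpos, fun i => ?_⟩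
  have hloc : IsLocalMax (g i) 0 := by
    have hnear : ∀ᶠ t : ℝ in nhds 0, 0 < φ i + t :=
      (continuous_const.add continuous_id).continuousAt.eventually_const_lt (by simpa using hpos i)
    filter_upwards [hnear] with t ht
    refine hg_le i t fun j => ?_
    by_cases hj : j = i
    · subst hj
      simpa using ht.le
    · simpa [hj] using hφ j
  linarith [hloc.hasDerivAt_eq_zero (hg i)]


/-- The graph Laplacian `(Δ φ)_i = (1/μ_i) ∑_j ω_ij (φ_j − φ_i)` on a finite
weighted graph. -/
noncomputable def graphLaplacian {V : Type*} [Fintype V] (μ : V → ℝ) (ω : V → V → ℝ)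
    (φ : V → ℝ) (i : V) : ℝ :=
  (1 / μ i) * ∑ j, ω i j * (φ j - φ i)

/-- **The Yamabe equation on a finite connected graph.**
If `α > 2` and `f > 0`, then `Δ φ + h φ = λ f φ^{α-1}` has a positive solution
`φ` for some constant `λ ∈ ℝ`. -/
theorem yamabe_equation_has_positive_solution
    {V : Type*} [Fintype V] [Nonempty V]
    (μ : V → ℝ) (hμ : ∀ i, 0 < μ i)
    (ω : V → V → ℝ) (hωsym : ∀ i j, ω i j = ω j i)
    (hωnonneg : ∀ i j, 0 ≤ ω i j) (hωloop : ∀ i, ω i i = 0)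
    (hconn : ∀ i j : V, Relation.ReflTransGen (fun a b => 0 < ω a b) i j)
    (h f : V → ℝ) (hf : ∀ i, 0 < f i)
    (α : ℝ) (hα : 2 < α) :
    ∃ (lam : ℝ) (φ : V → ℝ), (∀ i, 0 < φ i) ∧
      ∀ i, graphLaplacian μ ω φ i + h i * φ i = lam * f i * φ i ^ (α - 1) := by
  classical
  let B : Matrix V V ℝ :=
    Matrix.of ω + Matrix.diagonal fun i => h i * μ i - ∑ j, ω i j
  have hoff : ∀ i j, i ≠ j → B i j = ω i j := fun i j hij => by simp [B, hij]
  have hB : B.IsSymm :=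
    Matrix.IsSymm.add (Matrix.IsSymm.ext fun i j => hωsym j i) (Matrix.isSymm_diagonal _)
  obtain ⟨c, φ, hφ, heq⟩ := exists_pos_nonlinear_eigenvector hB
    (fun i j hij => (hoff i j hij).symm ▸ hωnonneg i j)
    (fun i j => Relation.ReflTransGen.mono (fun a b hab => by
      have hne : a ≠ b := by
        rintro rfl
        exact hab.ne' (hωloop a)
      exact ⟨hne, (hoff a b hne).symm ▸ hab⟩) i j (hconn i j))
    (fun i => μ i * f i) (fun i => mul_pos (hμ i) (hf i)) (one_lt_two.trans hα)
  refine ⟨c, φ, hφ, fun i => ?_⟩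
  have hi := heq i
  rw [Matrix.add_mulVec, Pi.add_apply, Matrix.mulVec_diagonal] at hi
  have hsum : (Matrix.of ω *ᵥ φ) i = ∑ j, ω i j * φ j := rfl
  have hμi := (hμ i).ne'
  simp only [graphLaplacian, mul_sub, Finset.sum_sub_distrib, ← Finset.sum_mul]
  rw [hsum] at hi
  field_simp
  linarith
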